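/- arXiv:math/0601096 — 4 statements merged into one kernel-verified Lean document; each statement's English description precedes it below -/
import Mathlib

section
/- For natural numbers n_e and n_o, one has n_e - (n_e - n_o)^2 >= 0 (the difference computed in the integers) if and only if there exist natural numbers k and l such that either (n_e, n_o) = (k^2 + l, k(k+1) + l) or (n_e, n_o) = ((k+1)^2 + l, k(k+1) + l). -/
/-- For natural numbers `n_e` and `n_o`, one has
`n_e - (n_e - n_o)^2 ≥ 0` (computed in the integers) if and only if there
exist natural numbers `k` and `l` such that either
`(n_e, n_o) = (k^2 + l, k*(k+1) + l)` or `(n_e, n_o) = ((k+1)^2 + l, k*(k+1) + l)`. -/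
theorem stmt0 (ne no : ℕ) :
    0 ≤ (ne : ℤ) - ((ne : ℤ) - (no : ℤ)) ^ 2 ↔
      ∃ k l : ℕ,
        (ne = k ^ 2 + l ∧ no = k * (k + 1) + l) ∨
        (ne = (k + 1) ^ 2 + l ∧ no = k * (k + 1) + l) := by
  constructor
  · intro h
    rcases le_or_gt ne no with hle | hlt
    · obtain ⟨k, rfl⟩ := Nat.exists_eq_add_of_le hle
      have h1 : k ^ 2 ≤ ne := by
        zify
        push_cast at h
        nlinarith
      obtain ⟨l, rfl⟩ := Nat.exists_eq_add_of_le h1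
      exact ⟨k, l, Or.inl ⟨rfl, by ring⟩⟩
    · obtain ⟨k, rfl⟩ := Nat.exists_eq_add_of_lt hlt
      have h1 : k * (k + 1) ≤ no := by
        zify
        push_cast at h
        nlinarith
      obtain ⟨l, rfl⟩ := Nat.exists_eq_add_of_le h1
      exact ⟨k, l, Or.inr ⟨by ring, rfl⟩⟩
  · rintro ⟨k, l, ⟨rfl, rfl⟩ | ⟨rfl, rfl⟩⟩
    · push_cast
      ring_nf
      positivity
    · push_cast
      ring_nf
      positivity
end

section
/- Let K be a field of characteristic zero, let m and n be natural numbers, let X, Y be m-by-n matrices over K and X', Y' be n-by-m matrices over K. Suppose the n-by-n matrix Z = Y'X - X'Y is invertible and that Y Z^{-1} X' - X Z^{-1} Y' equals the m-by-m identity matrix. Then m = 0 and n = 0. -/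
/-- Let `K` be a field of characteristic zero, `X Y` be `m × n` matrices and
`X' Y'` be `n × m` matrices over `K`.  If `Z = Y'X - X'Y` is invertible and
`Y Z⁻¹ X' - X Z⁻¹ Y' = I_m`, then `m = 0` and `n = 0`. -/
theorem stmt12 (K : Type*) [Field K] [CharZero K] (m n : ℕ)
    (X Y : Matrix (Fin m) (Fin n) K) (X' Y' : Matrix (Fin n) (Fin m) K)
    (hZ : IsUnit (Y' * X - X' * Y))
    (h : Y * (Y' * X - X' * Y)⁻¹ * X' - X * (Y' * X - X' * Y)⁻¹ * Y' = 1) :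
    m = 0 ∧ n = 0 := by
  have hW : (Y' * X - X' * Y) * (Y' * X - X' * Y)⁻¹ = 1 :=
    Matrix.mul_nonsing_inv _ ((Matrix.isUnit_iff_isUnit_det _).1 hZ)
  generalize (Y' * X - X' * Y)⁻¹ = W at h hW
  have h1 := congrArg Matrix.trace h
  have h2 := congrArg Matrix.trace hW
  rw [Matrix.trace_sub, Matrix.trace_mul_cycle Y, Matrix.trace_mul_cycle X,
    Matrix.trace_one, Fintype.card_fin] at h1
  rw [Matrix.sub_mul, Matrix.trace_sub, Matrix.trace_one, Fintype.card_fin] at h2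
  have h3 : ((m + n : ℕ) : K) = 0 := by
    push_cast
    rw [← h1, ← h2]
    ring
  have h4 : m + n = 0 := Nat.cast_eq_zero.1 h3
  omega
end

section
/- Let K be a field, let a, b, c be natural numbers, let X, Y be a-by-b matrices over K, let X', Y' be b-by-a matrices over K, and let X'', Y'' be c-by-b matrices over K. Set Z = Y'X - X'Y (a b-by-b matrix) and Z' = Y''X' - X''Y' (a c-by-a matrix). If the relations Y''Y'X - 2 Y''X'Y + X''Y'Y = 0 and X''X'Y - 2 X''Y'X + Y''X'X = 0 hold, then X''Z = Z'X and Y''Z = Z'Y; consequently, if Z is invertible, then Z' (Y Z^{-1} X' - X Z^{-1} Y') = Z'. -/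
/-- Let `K` be a field, `X Y : a × b`, `X' Y' : b × a`, `X'' Y'' : c × b`
matrices over `K`, and set `Z = Y'X - X'Y`, `Z' = Y''X' - X''Y'`.  If
`Y''Y'X - 2·Y''X'Y + X''Y'Y = 0` and `X''X'Y - 2·X''Y'X + Y''X'X = 0`, then
`X''Z = Z'X` and `Y''Z = Z'Y`; consequently, if `Z` is invertible, then
`Z'(Y Z⁻¹ X' - X Z⁻¹ Y') = Z'`. -/
theorem stmt13 (K : Type*) [Field K] (a b c : ℕ)
    (X Y : Matrix (Fin a) (Fin b) K) (X' Y' : Matrix (Fin b) (Fin a) K)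
    (X'' Y'' : Matrix (Fin c) (Fin b) K)
    (h1 : Y'' * Y' * X - (2 : K) • (Y'' * X' * Y) + X'' * Y' * Y = 0)
    (h2 : X'' * X' * Y - (2 : K) • (X'' * Y' * X) + Y'' * X' * X = 0) :
    (X'' * (Y' * X - X' * Y) = (Y'' * X' - X'' * Y') * X ∧
     Y'' * (Y' * X - X' * Y) = (Y'' * X' - X'' * Y') * Y) ∧
    (IsUnit (Y' * X - X' * Y) →
      (Y'' * X' - X'' * Y') *
          (Y * (Y' * X - X' * Y)⁻¹ * X' - X * (Y' * X - X' * Y)⁻¹ * Y')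
        = Y'' * X' - X'' * Y') := by
  have e1 : X'' * (Y' * X - X' * Y) = (Y'' * X' - X'' * Y') * X := by
    rw [← sub_eq_zero, ← neg_eq_zero, ← h2, two_smul]
    simp only [Matrix.mul_sub, Matrix.sub_mul, Matrix.mul_assoc]
    abel
  have e2 : Y'' * (Y' * X - X' * Y) = (Y'' * X' - X'' * Y') * Y := by
    rw [← sub_eq_zero, ← h1, two_smul]
    simp only [Matrix.mul_sub, Matrix.sub_mul, Matrix.mul_assoc]
    abel
  refine ⟨⟨e1, e2⟩, fun hZ => ?_⟩
  have hd := (Matrix.isUnit_iff_isUnit_det _).mp hZ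
  rw [Matrix.mul_sub, ← Matrix.mul_assoc, ← Matrix.mul_assoc, ← Matrix.mul_assoc,
    ← Matrix.mul_assoc, ← e1, ← e2, Matrix.mul_nonsing_inv_cancel_right _ _ hd,
    Matrix.mul_nonsing_inv_cancel_right _ _ hd]
end

section
/- Let K be an algebraically closed field of characteristic zero, and let n_e and n_o be natural numbers with n_e - (n_e - n_o)^2 >= 0 (computed in the integers). Then there exist n_e-by-n_o matrices X, Y over K and n_o-by-n_e matrices X', Y' over K such that Y'X - X'Y equals the n_o-by-n_o identity matrix and the n_e-by-n_e matrix YX' - XY' - I has rank at most 1. -/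
open Matrix in
theorem aux_blocks {K : Type*} [Field K] {I : Type*} [Fintype I] [DecidableEq I]
    (p : I → Prop) [DecidablePred p] (ne no : ℕ) (h1 : Fintype.card {i // p i} = ne)
    (h2 : Fintype.card {i // ¬ p i} = no) (X Y : Matrix I I K)
    (hX1 : ∀ i j, p i → p j → X i j = 0) (hX2 : ∀ i j, ¬ p i → ¬ p j → X i j = 0)
    (hY1 : ∀ i j, p i → p j → Y i j = 0) (hY2 : ∀ i j, ¬ p i → ¬ p j → Y i j = 0)
    (u v : I → K) (hu : ∀ i, ¬ p i → u i = 0)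
    (hc : Y * X - X * Y - 1 = vecMulVec u v) :
    ∃ (X Y : Matrix (Fin ne) (Fin no) K) (X' Y' : Matrix (Fin no) (Fin ne) K),
      Y' * X - X' * Y = 1 ∧ (Y * X' - X * Y' - 1).rank ≤ 1 := by
  let e1 : Fin ne ≃ {i // p i} := (Fintype.equivFinOfCardEq h1).symm
  let e2 : Fin no ≃ {i // ¬ p i} := (Fintype.equivFinOfCardEq h2).symm
  have key : ∀ i k, (Y * X) i k - (X * Y) i k - (1 : Matrix I I K) i k = u i * v k := by
    intro i k
    have := congrFun (congrFun hc i) k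
    simpa [vecMulVec_apply] using this
  have sumE : ∀ (A B : Matrix I I K) i k, (∀ j, p j → A i j = 0) →
      (A * B) i k = ∑ j : Fin no, A i (e2 j) * B (e2 j) k := by
    intro A B i k hA
    rw [mul_apply, ← Fintype.sum_subtype_add_sum_subtype p, Finset.sum_eq_zero, zero_add]
    · exact (Equiv.sum_comp e2 (fun j : {i // ¬ p i} => A i j * B j k)).symm
    · intro j _
      rw [hA j j.2, zero_mul]
  have sumO : ∀ (A B : Matrix I I K) i k, (∀ j, ¬ p j → A i j = 0) →
      (A * B) i k = ∑ j : Fin ne, A i (e1 j) * B (e1 j) k := by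
    intro A B i k hA
    rw [mul_apply, ← Fintype.sum_subtype_add_sum_subtype p, add_comm, Finset.sum_eq_zero, zero_add]
    · exact (Equiv.sum_comp e1 (fun j : {i // p i} => A i j * B j k)).symm
    · intro j _
      rw [hA j j.2, zero_mul]
  refine ⟨X.submatrix (fun i => (e1 i).1) (fun j => (e2 j).1), Y.submatrix (fun i => (e1 i).1) (fun j => (e2 j).1),
    X.submatrix (fun i => (e2 i).1) (fun j => (e1 j).1), Y.submatrix (fun i => (e2 i).1) (fun j => (e1 j).1), ?_, ?_⟩
  · ext i k
    have h := key (e2 i) (e2 k)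
    rw [sumO _ _ _ _ (fun j hj => hY2 _ _ (e2 i).2 hj),
      sumO _ _ _ _ (fun j hj => hX2 _ _ (e2 i).2 hj), hu _ (e2 i).2, zero_mul, sub_eq_zero] at h
    rw [Matrix.sub_apply, mul_apply, mul_apply]
    simp only [submatrix_apply]
    rw [h]
    simp [one_apply, Subtype.val_inj]
  · have : (Y.submatrix (fun i => (e1 i).1) (fun j => (e2 j).1) *
        X.submatrix (fun i => (e2 i).1) (fun j => (e1 j).1)
        - X.submatrix (fun i => (e1 i).1) (fun j => (e2 j).1) *
        Y.submatrix (fun i => (e2 i).1) (fun j => (e1 j).1) - 1) =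
        vecMulVec (fun i => u (e1 i)) (fun i => v (e1 i)) := by
      ext i k
      have h := key (e1 i) (e1 k)
      rw [sumE _ _ _ _ (fun j hj => hY1 _ _ (e1 i).2 hj),
        sumE _ _ _ _ (fun j hj => hX1 _ _ (e1 i).2 hj)] at h
      rw [vecMulVec_apply, ← h, Matrix.sub_apply, Matrix.sub_apply, mul_apply, mul_apply]
      simp [one_apply, Subtype.val_inj]
    rw [this]
    exact rank_vecMulVec_le _ _

open Matrix in
theorem aux_graded {K : Type*} [Field K] {ι : Type*} [Fintype ι] [DecidableEq ι]
    (b : Finset (Σ _ : ι, ℤ)) (Xm Ym : ℤ → Matrix ι ι K) (u v : ι → K)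
    (hX : ∀ j k d, ⟨j, d⟩ ∈ b → ⟨k, d + 1⟩ ∉ b → Xm d k j = 0)
    (hY : ∀ j k d, ⟨j, d⟩ ∈ b → ⟨k, d - 1⟩ ∉ b → Ym d k j = 0)
    (h1 : ∀ d, d ≠ 0 → Ym (d + 1) * Xm d - Xm (d - 1) * Ym d = 1)
    (h0 : Ym 1 * Xm 0 - Xm (-1) * Ym 0 - 1 = vecMulVec u v) :
    ∃ (X Y : Matrix (Fin (b.filter (fun s => Even s.2)).card)
        (Fin (b.filter (fun s => ¬ Even s.2)).card) K)
      (X' Y' : Matrix (Fin (b.filter (fun s => ¬ Even s.2)).card)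
        (Fin (b.filter (fun s => Even s.2)).card) K),
      Y' * X - X' * Y = 1 ∧ (Y * X' - X * Y' - 1).rank ≤ 1 := by
  have hsum : ∀ (f : (Σ _ : ι, ℤ) → K) (d : ℤ), (∀ s ∈ b, s.2 ≠ d → f s = 0) →
      (∀ k, ⟨k, d⟩ ∉ b → f ⟨k, d⟩ = 0) → ∑ s : b, f s = ∑ k, f ⟨k, d⟩ := by
    intro f d hf hf'
    rw [Finset.sum_coe_sort b f]
    have : ∑ k, f ⟨k, d⟩ = ∑ s ∈ Finset.univ.image (fun k : ι => (⟨k, d⟩ : Σ _ : ι, ℤ)), f s := by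
      rw [Finset.sum_image]
      intro x _ y _ h
      simpa using h
    rw [this]
    apply Finset.sum_congr_of_eq_on_inter
    · rintro ⟨k, e⟩ hs hn
      apply hf _ hs
      rintro rfl
      simp at hn
    · rintro ⟨k, e⟩ hs hn
      simp only [Finset.mem_image, Finset.mem_univ, true_and] at hs
      obtain ⟨k', hk⟩ := hs
      cases hk
      exact hf' _ hn
    · intros; rfl
  let X : Matrix b b K := fun s t => if s.1.2 = t.1.2 + 1 then Xm t.1.2 s.1.1 t.1.1 else 0
  let Y : Matrix b b K := fun s t => if s.1.2 = t.1.2 - 1 then Ym t.1.2 s.1.1 t.1.1 else 0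
  have hYX : ∀ s t : b, (Y * X) s t = if s.1.2 = t.1.2 then
      (Ym (t.1.2 + 1) * Xm t.1.2) s.1.1 t.1.1 else 0 := by
    intro s t
    rw [mul_apply]
    simp only [X, Y]
    rw [hsum (fun r => (if s.1.2 = r.2 - 1 then Ym r.2 s.1.1 r.1 else 0) *
      (if r.2 = t.1.2 + 1 then Xm t.1.2 r.1 t.1.1 else 0)) (t.1.2 + 1)]
    · split_ifs with h <;> simp [mul_apply, h]
    · intro r _ hr
      simp [hr]
    · intro k hk
      simp [hX t.1.1 k t.1.2 t.2 hk]
  have hXY : ∀ s t : b, (X * Y) s t = if s.1.2 = t.1.2 then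
      (Xm (t.1.2 - 1) * Ym t.1.2) s.1.1 t.1.1 else 0 := by
    intro s t
    rw [mul_apply]
    simp only [X, Y]
    rw [hsum (fun r => (if s.1.2 = r.2 + 1 then Xm r.2 s.1.1 r.1 else 0) *
      (if r.2 = t.1.2 - 1 then Ym t.1.2 r.1 t.1.1 else 0)) (t.1.2 - 1)]
    · split_ifs with h <;> simp [mul_apply, h]
    · intro r _ hr
      simp [hr]
    · intro k hk
      simp [hY t.1.1 k t.1.2 t.2 hk]
  refine aux_blocks (I := b) (fun s => Even s.1.2) _ _ ?_ ?_ X Y ?_ ?_ ?_ ?_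
    (fun s => if s.1.2 = 0 then u s.1.1 else 0) (fun s => if s.1.2 = 0 then v s.1.1 else 0) ?_ ?_
  · rw [Fintype.card_subtype, ← Finset.card_map (Function.Embedding.subtype _)]
    congr 1
    ext s
    simp only [Finset.mem_map, Finset.mem_filter, Finset.mem_univ, true_and,
      Function.Embedding.subtype_apply]
    exact ⟨fun ⟨t, ht, hts⟩ => hts ▸ ⟨t.2, ht⟩, fun hs => ⟨⟨s, hs.1⟩, hs.2, rfl⟩⟩
  · rw [Fintype.card_subtype, ← Finset.card_map (Function.Embedding.subtype _)]
    congr 1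
    ext s
    simp only [Finset.mem_map, Finset.mem_filter, Finset.mem_univ, true_and,
      Function.Embedding.subtype_apply]
    exact ⟨fun ⟨t, ht, hts⟩ => hts ▸ ⟨t.2, ht⟩, fun hs => ⟨⟨s, hs.1⟩, hs.2, rfl⟩⟩
  · intro i j hi hj
    simp only [X]
    rw [if_neg]
    intro h
    grind
  · intro i j hi hj
    simp only [X]
    rw [if_neg]
    intro h
    grind
  · intro i j hi hj
    simp only [Y]
    rw [if_neg]
    intro h
    grind
  · intro i j hi hj
    simp only [Y]
    rw [if_neg]
    intro h
    grind
  · intro i hi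
    rw [if_neg]
    intro h
    simp [h] at hi
  · ext ⟨⟨i, c⟩, hs⟩ ⟨⟨j, d⟩, ht⟩
    rw [Matrix.sub_apply, Matrix.sub_apply, hYX, hXY, vecMulVec_apply]
    simp only [one_apply, Subtype.mk.injEq, Sigma.mk.injEq, heq_eq_eq]
    by_cases hcd : c = d
    · subst hcd
      by_cases hc : c = 0
      · subst hc
        have := congrFun (congrFun h0 i) j
        simpa [vecMulVec_apply, one_apply] using this
      · have := congrFun (congrFun (h1 c hc) i) j
        simp only [Matrix.sub_apply, one_apply] at this
        simp [hc, this]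
    · by_cases hc : c = 0
      · subst hc
        simp [hcd, Ne.symm hcd]
      · simp [hcd, hc]

open Matrix Polynomial in
theorem aux_cauchy {K : Type*} [Field K] {r : ℕ} (x y : Fin r → K)
    (hx : Function.Injective x) (hy : Function.Injective y) (hxy : ∀ i j, x i ≠ y j) :
    IsUnit (Matrix.det (fun i j => (x i - y j)⁻¹ : Matrix (Fin r) (Fin r) K)) := by
  rw [isUnit_iff_ne_zero]
  intro hdet
  obtain ⟨w, hw, hz⟩ := Matrix.exists_mulVec_eq_zero_iff.2 hdet
  apply hw
  let f : K[X] := ∑ j, C (w j) * ∏ k ∈ Finset.univ.erase j, (X - C (y k))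
  have hev : ∀ i, f.eval (x i) = 0 := by
    intro i
    have h2 : ∀ j, w j * ∏ k ∈ Finset.univ.erase j, (x i - y k)
        = (∏ k, (x i - y k)) * ((x i - y j)⁻¹ * w j) := by
      intro j
      rw [← Finset.mul_prod_erase _ _ (Finset.mem_univ j)]
      have := sub_ne_zero.2 (hxy i j)
      field_simp
    have h3 := congrFun hz i
    simp only [mulVec, dotProduct, Pi.zero_apply] at h3
    simp only [f, eval_finsetSum, eval_mul, eval_C, eval_prod, eval_sub, eval_X, h2]
    rw [← Finset.mul_sum, h3, mul_zero]
  have hf : f = 0 := by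
    refine Polynomial.eq_zero_of_degree_lt_of_eval_index_eq_zero Finset.univ (v := x)
      hx.injOn ?_ ?_
    · rw [Finset.card_univ, Fintype.card_fin]
      refine lt_of_le_of_lt (Polynomial.degree_sum_le _ _) ?_
      rw [Finset.sup_lt_iff (WithBot.bot_lt_coe _)]
      intro j _
      by_cases hwj : w j = 0
      · simp [hwj, WithBot.bot_lt_coe]
      rw [degree_C_mul hwj, degree_prod]
      have : 0 < r := j.pos
      simp only [degree_X_sub_C, Finset.sum_const, Finset.card_erase_of_mem (Finset.mem_univ j),
        Finset.card_univ, Fintype.card_fin, nsmul_eq_mul, mul_one]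
      exact_mod_cast Nat.sub_lt this one_pos
    · intro i _
      exact hev i
  funext j
  have h4 : f.eval (y j) = 0 := by rw [hf, eval_zero]
  simp only [f, eval_finsetSum, eval_mul, eval_C, eval_prod, eval_sub, eval_X] at h4
  rw [Finset.sum_eq_single j] at h4
  · rcases mul_eq_zero.1 h4 with h | h
    · exact h
    · rw [Finset.prod_eq_zero_iff] at h
      obtain ⟨k, hk, h⟩ := h
      exact absurd (hy (sub_eq_zero.1 h)).symm (Finset.ne_of_mem_erase hk)
  · intro k _ hk
    rw [Finset.prod_eq_zero (i := j) (by simp [hk.symm]) (sub_self _), mul_zero]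
  · simp

theorem aux_count_even (a l : ℕ) :
    ((Finset.Icc (-(l : ℤ)) a).filter (fun s => Even s)).card = 1 + a / 2 + l / 2 := by
  induction a with
  | zero =>
    induction l with
    | zero => simp [Finset.filter_singleton]
    | succ l ih =>
      have : Finset.Icc (-((l + 1 : ℕ) : ℤ)) ((0 : ℕ) : ℤ)
          = insert (-((l + 1 : ℕ) : ℤ)) (Finset.Icc (-(l : ℤ)) ((0 : ℕ) : ℤ)) := by
        ext s; simp only [Finset.mem_Icc, Finset.mem_insert]; omega
      rw [this, Finset.filter_insert]
      split_ifs with h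
      · rw [Finset.card_insert_of_notMem (by simp), ih]
        grind
      · rw [ih]
        grind
  | succ a ih =>
    have : Finset.Icc (-(l : ℤ)) ((a + 1 : ℕ) : ℤ)
        = insert ((a + 1 : ℕ) : ℤ) (Finset.Icc (-(l : ℤ)) (a : ℤ)) := by
      ext s; simp only [Finset.mem_Icc, Finset.mem_insert]; omega
    rw [this, Finset.filter_insert]
    split_ifs with h
    · rw [Finset.card_insert_of_notMem (by simp), ih]
      grind
    · rw [ih]
      grind

theorem aux_count_odd (a l : ℕ) :
    ((Finset.Icc (-(l : ℤ)) a).filter (fun s => ¬ Even s)).card = (a + 1) / 2 + (l + 1) / 2 := by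
  have h1 := aux_count_even a l
  have h2 := Finset.card_filter_add_card_filter_not (s := Finset.Icc (-(l : ℤ)) a) (fun s => Even s)
  rw [Int.card_Icc] at h2
  omega

open Matrix in
theorem aux_frob {K : Type*} [Field K] [CharZero K] {r : ℕ} (a l : Fin r → ℕ)
    (ha : Function.Injective a) (hl : Function.Injective l) (ne no : ℕ)
    (hne : ne = ∑ i, (1 + a i / 2 + l i / 2))
    (hno : no = ∑ i, ((a i + 1) / 2 + (l i + 1) / 2)) :
    ∃ (X Y : Matrix (Fin ne) (Fin no) K) (X' Y' : Matrix (Fin no) (Fin ne) K),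
      Y' * X - X' * Y = 1 ∧ (Y * X' - X * Y' - 1).rank ≤ 1 := by
  let b : Finset (Σ _ : Fin r, ℤ) := Finset.univ.sigma (fun i => Finset.Icc (-(l i : ℤ)) (a i))
  have hb : ∀ i d, (⟨i, d⟩ : Σ _ : Fin r, ℤ) ∈ b ↔ -(l i : ℤ) ≤ d ∧ d ≤ a i := by
    intro i d; simp [b]
  have hcard : ∀ (q : ℤ → Prop) [DecidablePred q], (b.filter (fun s => q s.2)).card
      = ∑ i, ((Finset.Icc (-(l i : ℤ)) (a i)).filter q).card := by
    intro q _
    rw [← Finset.card_sigma]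
    congr 1
    ext ⟨i, d⟩
    simp [b]
  have e1 : (b.filter (fun s => Even s.2)).card = ne := by
    rw [hcard, hne]
    exact Finset.sum_congr rfl fun i _ => aux_count_even _ _
  have e2 : (b.filter (fun s => ¬ Even s.2)).card = no := by
    rw [hcard (fun d => ¬ Even d), hno]
    exact Finset.sum_congr rfl fun i _ => aux_count_odd _ _
  rw [← e1, ← e2]
  let P : Matrix (Fin r) (Fin r) K := Matrix.of fun i j => (-(a i : K) - ((l j : K) + 1))⁻¹
  have hxy : ∀ i j, -(a i : K) ≠ (l j : K) + 1 := by
    intro i j h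
    have : ((a i + l j + 1 : ℕ) : K) = 0 := by
      push_cast
      linear_combination -h
    exact absurd (Nat.cast_eq_zero.1 this) (by omega)
  have hP : IsUnit P.det := by
    apply aux_cauchy (fun i => -(a i : K)) (fun j => (l j : K) + 1) _ _ hxy
    · intro i j h
      exact ha (by simpa using h)
    · intro i j h
      exact hl (by simpa using h)
  let A : Matrix (Fin r) (Fin r) K := diagonal fun i => -(a i : K)
  let L : ℤ → Matrix (Fin r) (Fin r) K := fun d => diagonal fun i => (l i : K) + d
  have hAP : A * P - P * L 0 - P = vecMulVec 1 1 := by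
    ext i j
    simp only [A, L, P, Matrix.sub_apply, of_apply, diagonal_mul, mul_diagonal, vecMulVec_apply, Pi.one_apply]
    have := sub_ne_zero.2 (hxy i j)
    push_cast
    field_simp
    ring
  let Xm : ℤ → Matrix (Fin r) (Fin r) K := fun d =>
    if 0 ≤ d then diagonal fun i => (d : K) - a i else if d = -1 then P else 1
  let Ym : ℤ → Matrix (Fin r) (Fin r) K := fun d =>
    if 0 < d then 1 else if d = 0 then L 0 * P⁻¹ else L d
  apply aux_graded b Xm Ym 1 (1 ᵥ* P⁻¹)
  · intro j k d hj hk
    rw [hb] at hj hk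
    simp only [Xm, Ym]
    split_ifs with h h'
    · by_cases hjk : k = j
      · subst hjk
        have : d = a k := by omega
        simp [this]
      · rw [diagonal_apply_ne _ hjk]
    · omega
    · rw [one_apply_ne]
      rintro rfl
      omega
  · intro j k d hj hk
    rw [hb] at hj hk
    simp only [Xm, Ym]
    split_ifs with h h'
    · rw [one_apply_ne]
      rintro rfl
      omega
    · have : l k = 0 := by omega
      simp [L, diagonal_mul, this]
    · by_cases hjk : k = j
      · subst hjk
        have : d = - l k := by omega
        simp [L, this]
      · exact diagonal_apply_ne _ hjk
  · intro d hd
    simp only [Xm, Ym]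
    rcases lt_or_gt_of_ne hd with h | h
    · rw [if_neg (by omega), if_neg (by omega : ¬ (0 ≤ d - 1)), if_neg (by omega : ¬ d - 1 = -1),
        if_neg (by omega : ¬ 0 ≤ d), if_neg (by omega : ¬ 0 < d), if_neg hd, one_mul]
      have : (if d + 1 = 0 then L 0 * P⁻¹ else L (d + 1)) * (if d = -1 then P else 1)
          = L (d + 1) := by
        by_cases h1 : d = -1
        · subst h1
          simp [Matrix.mul_assoc, nonsing_inv_mul _ hP]
        · rw [if_neg (by omega), if_neg h1, mul_one]
      rw [this]
      simp only [L, diagonal_sub, ← diagonal_one]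
      congr 1
      funext i
      push_cast
      ring
    · rw [if_pos (by omega), if_pos (by omega), if_pos (by omega), if_pos (by omega)]
      rw [one_mul, mul_one, diagonal_sub, ← diagonal_one]
      congr 1
      funext i
      push_cast
      ring
  · have h1 : vecMulVec (1 : Fin r → K) (1 ᵥ* P⁻¹) = (A * P - P * L 0 - P) * P⁻¹ := by
      rw [hAP, vecMulVec_mul]
    rw [h1, sub_mul, sub_mul, Matrix.mul_assoc, mul_nonsing_inv _ hP, Matrix.mul_assoc]
    simp [A, Xm, Ym]

/-- Let `K` be an algebraically closed field of characteristic zero and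
`n_e`, `n_o` natural numbers with `n_e - (n_e - n_o)² ≥ 0` (in `ℤ`).  Then there exist
`n_e × n_o` matrices `X, Y` and `n_o × n_e` matrices `X', Y'` over `K` with
`Y'X - X'Y = I` and `rank(YX' - XY' - I) ≤ 1`. -/
theorem stmt14 (K : Type*) [Field K] [IsAlgClosed K] [CharZero K] (ne no : ℕ)
    (h : 0 ≤ (ne : ℤ) - ((ne : ℤ) - (no : ℤ)) ^ 2) :
    ∃ (X Y : Matrix (Fin ne) (Fin no) K) (X' Y' : Matrix (Fin no) (Fin ne) K),
      Y' * X - X' * Y = 1 ∧ (Y * X' - X * Y' - 1).rank ≤ 1 := by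
  have hs : ∀ r : ℕ, ∑ i : Fin r, (1 + 2 * (i : ℕ)) = r ^ 2 := by
    intro r
    induction r with
    | zero => simp
    | succ r ih => rw [Fin.sum_univ_castSucc]; simp only [Fin.val_castSucc, Fin.val_last, ih]; ring
  have hm : ∀ r m : ℕ, ∑ i : Fin (r + 1), (if i = Fin.last r then m else 0) = m := by
    intro r m; simp
  rcases lt_trichotomy ne no with hlt | heq | hgt
  · obtain ⟨r, rfl⟩ : ∃ r, no = ne + (r + 1) := ⟨no - ne - 1, by omega⟩
    obtain ⟨m, rfl⟩ : ∃ m, ne = (r + 1) ^ 2 + m := by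
      apply Nat.exists_eq_add_of_le
      zify
      push_cast at h
      linarith
    have inj : Function.Injective
        (fun i : Fin (r + 1) => 2 * (i : ℕ) + 1 + 2 * (if i = Fin.last r then m else 0)) := by
      intro i j hij
      simp only [Fin.ext_iff, Fin.val_last] at hij ⊢
      grind
    apply aux_frob (fun i : Fin (r + 1) => 2 * (i : ℕ) + 1 + 2 * (if i = Fin.last r then m else 0))
      (fun i => 2 * (i : ℕ) + 1) inj
    · intro i j hij
      simp only at hij
      omega
    · rw [← hs]
      nth_rw 1 [← hm r m]
      rw [← Finset.sum_add_distrib]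
      apply Finset.sum_congr rfl
      intro i _
      omega
    · rw [← hs]
      nth_rw 1 [← hm r m]
      have : ∀ s : ℕ, s + (r + 1) = s + ∑ i : Fin (r + 1), 1 := by simp
      rw [this, ← Finset.sum_add_distrib, ← Finset.sum_add_distrib]
      apply Finset.sum_congr rfl
      intro i _
      omega
  · subst heq
    rcases Nat.eq_zero_or_pos ne with h0 | h0
    · subst h0
      exact aux_frob (r := 0) (fun _ => 0) (fun _ => 0) (fun i => i.elim0) (fun i => i.elim0)
        _ _ (by simp) (by simp)
    · refine aux_frob (r := 1) (fun _ => 2 * ne - 1) (fun _ => 0)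
        (Function.injective_of_subsingleton _) (Function.injective_of_subsingleton _) _ _ ?_ ?_
      · simp; omega
      · simp; omega
  · obtain ⟨r, rfl⟩ : ∃ r, ne = no + (r + 1) := ⟨ne - no - 1, by omega⟩
    obtain ⟨m, hmm⟩ : ∃ m, no + (r + 1) = (r + 1) ^ 2 + m := by
      apply Nat.exists_eq_add_of_le
      zify
      push_cast at h
      linarith
    have inj : Function.Injective
        (fun i : Fin (r + 1) => 2 * (i : ℕ) + 2 * (if i = Fin.last r then m else 0)) := by
      intro i j hij
      simp only [Fin.ext_iff, Fin.val_last] at hij ⊢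
      grind
    have hne : no + (r + 1) = ∑ i : Fin (r + 1), (1 + (2 * (i : ℕ) +
        2 * (if i = Fin.last r then m else 0)) / 2 + (2 * (i : ℕ)) / 2) := by
      rw [hmm, ← hs]
      nth_rw 1 [← hm r m]
      rw [← Finset.sum_add_distrib]
      apply Finset.sum_congr rfl
      intro i _
      omega
    apply aux_frob (fun i : Fin (r + 1) => 2 * (i : ℕ) + 2 * (if i = Fin.last r then m else 0))
      (fun i => 2 * (i : ℕ)) inj
    · intro i j hij
      simp only at hij
      omega
    · exact hne
    · have : ∀ s : ℕ, s + (r + 1) = s + ∑ i : Fin (r + 1), 1 := by simp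
      apply Nat.add_right_cancel (m := r + 1)
      rw [hne, this, ← Finset.sum_add_distrib]
      apply Finset.sum_congr rfl
      intro i _
      omega
end
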